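/- arXiv:2006.08739 — 8 statements merged into one kernel-verified Lean document; each statement's English description precedes it below -/
import Mathlib

section
/- Let Q₁, …, Q_k ∈ ℝ^{n×n} be symmetric positive definite and let H = ⊕_{i=1}^k E(Q_i) be the Minkowski sum of the corresponding ellipsoids. Then the topological boundary of the convex set H is exactly the set { Σ_{i=1}^k ⟨ℓ, Q_i ℓ⟩^{-1/2} Q_i ℓ : ℓ ∈ ℝⁿ, ‖ℓ‖ = 1 }. -/
open Matrix
open scoped Pointwise

namespace EllipsoidSum

section Single

variable {n : ℕ} {Q : Matrix (Fin n) (Fin n) ℝ}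

/-- The ellipsoid `{x | xᵀ Q⁻¹ x ≤ 1}`. -/
def ellipsoid (Q : Matrix (Fin n) (Fin n) ℝ) : Set (Fin n → ℝ) :=
  {x | x ⬝ᵥ (Q⁻¹ *ᵥ x) ≤ 1}

/-- The support function of the ellipsoid of `Q`. -/
noncomputable def supportValue (Q : Matrix (Fin n) (Fin n) ℝ) (l : Fin n → ℝ) : ℝ :=
  Real.sqrt (l ⬝ᵥ (Q *ᵥ l))

/-- The point of the ellipsoid of `Q` that is extremal in direction `l`. -/
noncomputable def supportPoint (Q : Matrix (Fin n) (Fin n) ℝ) (l : Fin n → ℝ) : Fin n → ℝ :=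
  (supportValue Q l)⁻¹ • (Q *ᵥ l)

lemma dotProduct_mulVec_comm (hQ : Q.PosDef) (x y : Fin n → ℝ) :
    x ⬝ᵥ (Q *ᵥ y) = y ⬝ᵥ (Q *ᵥ x) := by
  have hs : Qᵀ = Q := by simpa [IsHermitian, conjTranspose_eq_transpose_of_trivial] using hQ.1
  rw [dotProduct_mulVec, ← mulVec_transpose, hs, dotProduct_comm]

lemma inv_mulVec_mulVec (hQ : Q.PosDef) (l : Fin n → ℝ) : Q⁻¹ *ᵥ (Q *ᵥ l) = l := by
  rw [mulVec_mulVec, nonsing_inv_mul _ ((isUnit_iff_isUnit_det _).1 hQ.isUnit), one_mulVec]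

lemma dotProduct_mulVec_pos (hQ : Q.PosDef) {x : Fin n → ℝ} (hx : x ≠ 0) :
    0 < x ⬝ᵥ (Q *ᵥ x) := by
  simpa using hQ.dotProduct_mulVec_pos hx

lemma dotProduct_mulVec_nonneg (hQ : Q.PosDef) (x : Fin n → ℝ) : 0 ≤ x ⬝ᵥ (Q *ᵥ x) := by
  simpa using hQ.posSemidef.dotProduct_mulVec_nonneg x

lemma dotProduct_mulVec_sub (hQ : Q.PosDef) (x y : Fin n → ℝ) :
    (x - y) ⬝ᵥ (Q *ᵥ (x - y)) =
      x ⬝ᵥ (Q *ᵥ x) - 2 * (x ⬝ᵥ (Q *ᵥ y)) + y ⬝ᵥ (Q *ᵥ y) := by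
  simp only [mulVec_sub, dotProduct_sub, sub_dotProduct, dotProduct_mulVec_comm hQ y x]
  ring

lemma supportValue_pos (hQ : Q.PosDef) {l : Fin n → ℝ} (hl : l ≠ 0) : 0 < supportValue Q l :=
  Real.sqrt_pos.2 (dotProduct_mulVec_pos hQ hl)

lemma supportValue_sq (hQ : Q.PosDef) (l : Fin n → ℝ) :
    supportValue Q l * supportValue Q l = l ⬝ᵥ (Q *ᵥ l) :=
  Real.mul_self_sqrt (dotProduct_mulVec_nonneg hQ l)

lemma dotProduct_supportPoint (hQ : Q.PosDef) {l : Fin n → ℝ} (hl : l ≠ 0) :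
    l ⬝ᵥ supportPoint Q l = supportValue Q l := by
  have hs := (supportValue_pos hQ hl).ne'
  rw [supportPoint, dotProduct_smul, ← supportValue_sq hQ, smul_eq_mul, inv_mul_cancel_left₀ hs]

lemma dotProduct_inv_mulVec_supportPoint (hQ : Q.PosDef) (l x : Fin n → ℝ) :
    x ⬝ᵥ (Q⁻¹ *ᵥ supportPoint Q l) = (supportValue Q l)⁻¹ * (l ⬝ᵥ x) := by
  rw [supportPoint, mulVec_smul, inv_mulVec_mulVec hQ, dotProduct_smul, smul_eq_mul,
    dotProduct_comm]

lemma supportPoint_quadratic (hQ : Q.PosDef) {l : Fin n → ℝ} (hl : l ≠ 0) :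
    supportPoint Q l ⬝ᵥ (Q⁻¹ *ᵥ supportPoint Q l) = 1 := by
  rw [dotProduct_inv_mulVec_supportPoint hQ, dotProduct_supportPoint hQ hl,
    inv_mul_cancel₀ (supportValue_pos hQ hl).ne']

lemma supportPoint_mem (hQ : Q.PosDef) {l : Fin n → ℝ} (hl : l ≠ 0) :
    supportPoint Q l ∈ ellipsoid Q :=
  (supportPoint_quadratic hQ hl).le

lemma quadratic_sub_supportPoint_le (hQ : Q.PosDef) {l x : Fin n → ℝ} (hl : l ≠ 0)
    (hx : x ∈ ellipsoid Q) :
    (x - supportPoint Q l) ⬝ᵥ (Q⁻¹ *ᵥ (x - supportPoint Q l)) ≤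
      2 - 2 * ((supportValue Q l)⁻¹ * (l ⬝ᵥ x)) := by
  have hx' : x ⬝ᵥ (Q⁻¹ *ᵥ x) ≤ 1 := hx
  rw [dotProduct_mulVec_sub hQ.inv, supportPoint_quadratic hQ hl,
    dotProduct_inv_mulVec_supportPoint hQ]
  linarith

lemma dotProduct_le_supportValue (hQ : Q.PosDef) {l x : Fin n → ℝ} (hl : l ≠ 0)
    (hx : x ∈ ellipsoid Q) : l ⬝ᵥ x ≤ supportValue Q l := by
  have h := quadratic_sub_supportPoint_le hQ hl hx
  have h0 := dotProduct_mulVec_nonneg hQ.inv (x - supportPoint Q l)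
  have h1 : (supportValue Q l)⁻¹ * (l ⬝ᵥ x) ≤ 1 := by linarith
  rwa [inv_mul_le_iff₀ (supportValue_pos hQ hl), mul_one] at h1

lemma eq_supportPoint (hQ : Q.PosDef) {l x : Fin n → ℝ} (hl : l ≠ 0)
    (hx : x ∈ ellipsoid Q) (h : l ⬝ᵥ x = supportValue Q l) : x = supportPoint Q l := by
  have h1 := quadratic_sub_supportPoint_le hQ hl hx
  rw [h, inv_mul_cancel₀ (supportValue_pos hQ hl).ne'] at h1
  by_contra hne
  have := dotProduct_mulVec_pos hQ.inv (sub_ne_zero.2 hne)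
  linarith

lemma continuous_quadratic (M : Matrix (Fin n) (Fin n) ℝ) :
    Continuous fun x : Fin n → ℝ => x ⬝ᵥ (M *ᵥ x) := by
  fun_prop

lemma isCompact_ellipsoid (hQ : Q.PosDef) : IsCompact (ellipsoid Q) := by
  have hbox : IsCompact (Set.univ.pi fun j : Fin n =>
      Set.Icc (-supportValue Q (-Pi.single j 1)) (supportValue Q (Pi.single j 1))) :=
    isCompact_univ_pi fun _ => isCompact_Icc
  refine hbox.of_isClosed_subset
    (isClosed_le (continuous_quadratic _) continuous_const) fun x hx j _ => ?_
  have hj : (Pi.single j 1 : Fin n → ℝ) ≠ 0 := by simp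
  have h1 := dotProduct_le_supportValue hQ hj hx
  have h2 := dotProduct_le_supportValue hQ (neg_ne_zero.2 hj) hx
  rw [neg_dotProduct, single_one_dotProduct] at h2
  rw [single_one_dotProduct] at h1
  exact ⟨by linarith, h1⟩

lemma convex_ellipsoid (hQ : Q.PosDef) : Convex ℝ (ellipsoid Q) := by
  intro x hx y hy a b ha hb hab
  have hx' : x ⬝ᵥ (Q⁻¹ *ᵥ x) ≤ 1 := hx
  have hy' : y ⬝ᵥ (Q⁻¹ *ᵥ y) ≤ 1 := hy
  have h := dotProduct_mulVec_nonneg hQ.inv (x - y)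
  rw [dotProduct_mulVec_sub hQ.inv] at h
  have hB : x ⬝ᵥ (Q⁻¹ *ᵥ y) ≤ 1 := by linarith
  change (a • x + b • y) ⬝ᵥ (Q⁻¹ *ᵥ (a • x + b • y)) ≤ 1
  simp only [mulVec_add, mulVec_smul, dotProduct_add, add_dotProduct, dotProduct_smul,
    smul_dotProduct, smul_eq_mul, dotProduct_mulVec_comm hQ.inv y x]
  obtain rfl : b = 1 - a := by linarith
  nlinarith [mul_nonneg ha hb, mul_nonneg (mul_nonneg ha hb) (sub_nonneg.2 hB),
    mul_nonneg (mul_nonneg ha ha) (sub_nonneg.2 hx'),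
    mul_nonneg (mul_nonneg hb hb) (sub_nonneg.2 hy')]

lemma zero_mem_ellipsoid (Q : Matrix (Fin n) (Fin n) ℝ) : (0 : Fin n → ℝ) ∈ ellipsoid Q := by
  simp [ellipsoid]

lemma zero_mem_interior_ellipsoid (Q : Matrix (Fin n) (Fin n) ℝ) :
    (0 : Fin n → ℝ) ∈ interior (ellipsoid Q) :=
  mem_interior.2 ⟨{x | x ⬝ᵥ (Q⁻¹ *ᵥ x) < 1}, fun x (hx : x ⬝ᵥ (Q⁻¹ *ᵥ x) < 1) => hx.le,
    isOpen_lt (continuous_quadratic _) continuous_const, by simp⟩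

end Single

section Sum

variable {n k : ℕ} {Q : Fin k → Matrix (Fin n) (Fin n) ℝ}

lemma mem_sum_ellipsoid {x : Fin n → ℝ} :
    x ∈ ∑ i, ellipsoid (Q i) ↔
      ∃ y : Fin k → Fin n → ℝ, (∀ i, y i ∈ ellipsoid (Q i)) ∧ ∑ i, y i = x := by
  simp [Set.mem_fintype_sum]

lemma isCompact_sum_ellipsoid (hQ : ∀ i, (Q i).PosDef) :
    IsCompact (∑ i, ellipsoid (Q i)) :=
  Finset.sum_induction _ IsCompact (fun _ _ ha hb => ha.add hb) isCompact_singleton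
    fun i _ => isCompact_ellipsoid (hQ i)

lemma convex_sum_ellipsoid (hQ : ∀ i, (Q i).PosDef) :
    Convex ℝ (∑ i, ellipsoid (Q i)) :=
  convex_sum _ fun i _ => convex_ellipsoid (hQ i)

lemma zero_mem_interior_sum_ellipsoid (hk : 0 < k) :
    (0 : Fin n → ℝ) ∈ interior (∑ i, ellipsoid (Q i)) := by
  refine interior_mono (fun x hx => ?_) (zero_mem_interior_ellipsoid (Q ⟨0, hk⟩))
  refine mem_sum_ellipsoid.2 ⟨Pi.single ⟨0, hk⟩ x, fun i => ?_, by simp⟩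
  obtain rfl | hi := eq_or_ne i ⟨0, hk⟩
  · simpa using hx
  · simpa [hi] using zero_mem_ellipsoid (Q i)

lemma sum_supportPoint_mem (hQ : ∀ i, (Q i).PosDef) {l : Fin n → ℝ} (hl : l ≠ 0) :
    ∑ i, supportPoint (Q i) l ∈ ∑ i, ellipsoid (Q i) :=
  mem_sum_ellipsoid.2 ⟨_, fun i => supportPoint_mem (hQ i) hl, rfl⟩

lemma dotProduct_sum_supportPoint (hQ : ∀ i, (Q i).PosDef) {l : Fin n → ℝ} (hl : l ≠ 0) :
    l ⬝ᵥ ∑ i, supportPoint (Q i) l = ∑ i, supportValue (Q i) l := by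
  rw [dotProduct_sum]
  exact Finset.sum_congr rfl fun i _ => dotProduct_supportPoint (hQ i) hl

lemma dotProduct_le_sum_supportValue (hQ : ∀ i, (Q i).PosDef) {l x : Fin n → ℝ} (hl : l ≠ 0)
    (hx : x ∈ ∑ i, ellipsoid (Q i)) : l ⬝ᵥ x ≤ ∑ i, supportValue (Q i) l := by
  obtain ⟨y, hy, rfl⟩ := mem_sum_ellipsoid.1 hx
  rw [dotProduct_sum]
  exact Finset.sum_le_sum fun i _ => dotProduct_le_supportValue (hQ i) hl (hy i)

lemma eq_sum_supportPoint (hQ : ∀ i, (Q i).PosDef) {l x : Fin n → ℝ} (hl : l ≠ 0)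
    (hx : x ∈ ∑ i, ellipsoid (Q i)) (h : ∑ i, supportValue (Q i) l ≤ l ⬝ᵥ x) :
    x = ∑ i, supportPoint (Q i) l := by
  have heq := (dotProduct_le_sum_supportValue hQ hl hx).antisymm h
  obtain ⟨y, hy, rfl⟩ := mem_sum_ellipsoid.1 hx
  rw [dotProduct_sum, Finset.sum_eq_sum_iff_of_le
    fun i _ => dotProduct_le_supportValue (hQ i) hl (hy i)] at heq
  exact Finset.sum_congr rfl fun i hi => eq_supportPoint (hQ i) hl (hy i) (heq i hi)

lemma sum_supportPoint_notMem_interior (hQ : ∀ i, (Q i).PosDef) {l : Fin n → ℝ} (hl : l ≠ 0) :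
    ∑ i, supportPoint (Q i) l ∉ interior (∑ i, ellipsoid (Q i)) := by
  intro hint
  set x := ∑ i, supportPoint (Q i) l with hx
  have hc : Filter.Tendsto (fun t : ℝ => x + t • l) (nhdsWithin 0 (Set.Ioi 0)) (nhds x) := by
    have : Continuous fun t : ℝ => x + t • l := by fun_prop
    simpa using (this.tendsto 0).mono_left nhdsWithin_le_nhds
  obtain ⟨t, ht, htpos⟩ :=
    ((hc.eventually (mem_interior_iff_mem_nhds.1 hint)).and self_mem_nhdsWithin).exists
  have h := dotProduct_le_sum_supportValue hQ hl ht
  rw [dotProduct_add, dotProduct_smul, hx, dotProduct_sum_supportPoint hQ hl, smul_eq_mul] at h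
  have hll : 0 < l ⬝ᵥ l := by simpa using dotProduct_mulVec_pos PosDef.one hl
  have := mul_pos htpos hll
  linarith

/-- A supporting hyperplane with unit normal at a point outside the interior. -/
lemma exists_unit_normal {s : Set (Fin n → ℝ)} (hs : Convex ℝ s) (hne : (interior s).Nonempty)
    {x : Fin n → ℝ} (hx : x ∉ interior s) :
    ∃ l : Fin n → ℝ, l ⬝ᵥ l = 1 ∧ ∀ y ∈ s, l ⬝ᵥ y ≤ l ⬝ᵥ x := by
  obtain ⟨f, hf⟩ := geometric_hahn_banach_open_point hs.interior isOpen_interior hx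
  obtain ⟨m, hm⟩ : ∃ m : Fin n → ℝ, ∀ y, f y = m ⬝ᵥ y :=
    ⟨fun j => f (Pi.single j 1), fun y => by
      conv_lhs => rw [pi_eq_sum_univ' y]
      simp [dotProduct, mul_comm]⟩
  have hm0 : m ≠ 0 := by
    rintro rfl
    obtain ⟨y, hy⟩ := hne
    simpa [hm] using hf y hy
  have hmm : 0 < m ⬝ᵥ m := by simpa using dotProduct_mulVec_pos PosDef.one hm0
  have hle : ∀ y ∈ s, m ⬝ᵥ y ≤ m ⬝ᵥ x := by
    intro y hy
    have hcl : y ∈ closure (interior s) :=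
      hs.closure_interior_eq_closure_of_nonempty_interior hne ▸ subset_closure hy
    have hsub : closure (interior s) ⊆ {y | f y ≤ f x} :=
      closure_minimal (fun z hz => (hf z hz).le) (isClosed_le f.continuous continuous_const)
    simpa [hm] using hsub hcl
  refine ⟨(Real.sqrt (m ⬝ᵥ m))⁻¹ • m, ?_, fun y hy => ?_⟩
  · have hsq := Real.mul_self_sqrt hmm.le
    have hpos := Real.sqrt_pos.2 hmm
    rw [smul_dotProduct, dotProduct_smul, smul_eq_mul, smul_eq_mul]
    conv_lhs => rw [← hsq]
    rw [Real.sqrt_mul_self hpos.le]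
    field_simp
  · rw [smul_dotProduct, smul_dotProduct]
    exact smul_le_smul_of_nonneg_left (hle y hy) (by positivity)

theorem frontier_sum_ellipsoid (hk : 0 < k) (hQ : ∀ i, (Q i).PosDef) :
    frontier (∑ i, ellipsoid (Q i)) =
      {x | ∃ l : Fin n → ℝ, l ⬝ᵥ l = 1 ∧ x = ∑ i, supportPoint (Q i) l} := by
  have hne : ∀ l : Fin n → ℝ, l ⬝ᵥ l = 1 → l ≠ 0 := by
    rintro l hl rfl
    simp at hl
  rw [(isCompact_sum_ellipsoid hQ).isClosed.frontier_eq]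
  ext x
  constructor
  · rintro ⟨hxH, hxint⟩
    obtain ⟨l, hl, hmax⟩ := exists_unit_normal (convex_sum_ellipsoid hQ)
      ⟨0, zero_mem_interior_sum_ellipsoid hk⟩ hxint
    refine ⟨l, hl, eq_sum_supportPoint hQ (hne l hl) hxH ?_⟩
    rw [← dotProduct_sum_supportPoint hQ (hne l hl)]
    exact hmax _ (sum_supportPoint_mem hQ (hne l hl))
  · rintro ⟨l, hl, rfl⟩
    exact ⟨sum_supportPoint_mem hQ (hne l hl), sum_supportPoint_notMem_interior hQ (hne l hl)⟩

end Sum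

end EllipsoidSum

/-- For symmetric positive definite `Q₁, …, Q_k` and
`H = ⊕ᵢ E(Qᵢ)` the Minkowski sum of the ellipsoids, the topological boundary of `H`
is exactly `{ Σᵢ ⟨ℓ, Qᵢℓ⟩^{-1/2} Qᵢℓ : ‖ℓ‖ = 1 }` (unit length expressed as `ℓ ⬝ᵥ ℓ = 1`). -/
theorem stmt_2 {n k : ℕ} (hk : 0 < k) (Q : Fin k → Matrix (Fin n) (Fin n) ℝ)
    (hQsymm : ∀ i, (Q i).IsSymm) (hQpos : ∀ i, (Q i).PosDef)
    (H : Set (Fin n → ℝ))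
    (hH : H = ∑ i : Fin k, {x : Fin n → ℝ | x ⬝ᵥ ((Q i)⁻¹ *ᵥ x) ≤ 1}) :
    frontier H =
      {x : Fin n → ℝ | ∃ ℓ : Fin n → ℝ, ℓ ⬝ᵥ ℓ = 1 ∧
        x = ∑ i : Fin k, (Real.sqrt (ℓ ⬝ᵥ (Q i *ᵥ ℓ)))⁻¹ • (Q i *ᵥ ℓ)} := by
  subst hH
  exact EllipsoidSum.frontier_sum_ellipsoid hk hQpos
end

section
/- Let Q₁, …, Q_k ∈ ℝ^{n×n} be symmetric positive definite, let p_{ij} > 0 be given for every pair (i, j) with 1 ≤ i < j ≤ k, and define Q = Σ_{i=1}^k Q_i + Σ_{1≤i<j≤k} ( p_{ij} Q_i + p_{ij}^{-1} Q_j ). Then Q is symmetric positive definite and the Minkowski sum ⊕_{i=1}^k E(Q_i) is contained in the ellipsoid E(Q). -/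
open Matrix Finset
open scoped Pointwise

/-- The square of a finite sum, bounded by weighted squares via Young's inequality. -/
lemma sq_sum_le_of_weights {ι : Type*} [Fintype ι] [LinearOrder ι] (p : ι → ι → ℝ)
    (hp : ∀ i j, i < j → 0 < p i j) (s : ι → ℝ) :
    (∑ i, s i) ^ 2 ≤ ∑ i, s i ^ 2 +
      ∑ i, ∑ j ∈ univ.filter (fun j => i < j), (p i j * s i ^ 2 + (p i j)⁻¹ * s j ^ 2) := by
  have h_split : (∑ i, s i) ^ 2 = ∑ i, s i ^ 2 +
      2 * ∑ i, ∑ j ∈ univ.filter (fun j => i < j), s i * s j := by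
    have h_swap : ∑ i, ∑ j, (if j < i then s i * s j else 0) =
        ∑ i, ∑ j, (if i < j then s i * s j else 0) := by
      rw [sum_comm]
      simp_rw [mul_comm]
    have h_term : ∀ i j, s i * s j = (if i = j then s i * s j else 0) +
        (if i < j then s i * s j else 0) + (if j < i then s i * s j else 0) := by
      intro i j
      rcases lt_trichotomy i j with h | h | h
      · simp [h, h.ne, h.not_gt]
      · simp [h]
      · simp [h, h.ne', h.not_gt]
    rw [sq, sum_mul_sum]
    calc ∑ i, ∑ j, s i * s j
        = ∑ i, ∑ j, ((if i = j then s i * s j else 0) +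
            (if i < j then s i * s j else 0) + (if j < i then s i * s j else 0)) :=
          sum_congr rfl fun i _ => sum_congr rfl fun j _ => h_term i j
      _ = _ := by
          simp only [sum_add_distrib, h_swap, sum_filter, sum_ite_eq, mem_univ, if_true, ← sq]
          ring
  rw [h_split]
  simp only [mul_sum]
  gcongr with i _ j hj
  have hpos := hp i j (mem_filter.mp hj).2
  have h_sq : p i j * s i ^ 2 + (p i j)⁻¹ * s j ^ 2 - 2 * (s i * s j) =
      (p i j)⁻¹ * (p i j * s i - s j) ^ 2 := by
    field_simp
    ring
  have : 0 ≤ (p i j)⁻¹ * (p i j * s i - s j) ^ 2 := by positivity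
  linarith

/-- The support function bound for an ellipsoid. -/
lemma sq_dotProduct_le_of_mem_ellipsoid {ι : Type*} [Fintype ι] [DecidableEq ι]
    {A : Matrix ι ι ℝ} (hA : A.PosDef) {x : ι → ℝ} (hx : x ⬝ᵥ (A⁻¹ *ᵥ x) ≤ 1) (y : ι → ℝ) :
    (y ⬝ᵥ x) ^ 2 ≤ y ⬝ᵥ (A *ᵥ y) := by
  have h_symm : Aᵀ = A := by simpa using hA.isHermitian.eq
  set z := A⁻¹ *ᵥ x with hz
  have hAz : A *ᵥ z = x := by
    rw [hz, mulVec_mulVec, mul_nonsing_inv _ ((isUnit_iff_isUnit_det A).mp hA.isUnit), one_mulVec]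
  have h_nonneg : 0 ≤ (y - (y ⬝ᵥ x) • z) ⬝ᵥ (A *ᵥ (y - (y ⬝ᵥ x) • z)) := by
    simpa using hA.posSemidef.dotProduct_mulVec_nonneg (y - (y ⬝ᵥ x) • z)
  have h_cross : z ⬝ᵥ (A *ᵥ y) = y ⬝ᵥ x := by
    rw [dotProduct_mulVec, ← mulVec_transpose, h_symm, hAz, dotProduct_comm]
  simp only [mulVec_sub, mulVec_smul, hAz, sub_dotProduct, dotProduct_sub, smul_dotProduct,
    dotProduct_smul, h_cross, smul_eq_mul, dotProduct_comm z x] at h_nonneg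
  nlinarith [mul_le_mul_of_nonneg_left hx (sq_nonneg (y ⬝ᵥ x))]



/-- For symmetric positive definite `Q₁, …, Q_k`, positive `p_{ij}` (`i < j`),
and `Q = Σᵢ Qᵢ + Σ_{i<j} (p_{ij} Qᵢ + p_{ij}⁻¹ Qⱼ)`, the matrix `Q` is symmetric positive
definite and the Minkowski sum `⊕ᵢ E(Qᵢ)` is contained in the ellipsoid `E(Q)`. -/
theorem stmt_4 {n k : ℕ} (hk : 0 < k) (Qs : Fin k → Matrix (Fin n) (Fin n) ℝ)
    (hQsymm : ∀ i, (Qs i).IsSymm) (hQpos : ∀ i, (Qs i).PosDef)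
    (p : Fin k → Fin k → ℝ) (hp : ∀ i j, i < j → 0 < p i j)
    (Q : Matrix (Fin n) (Fin n) ℝ)
    (hQ : Q = ∑ i, Qs i +
        ∑ i, ∑ j ∈ univ.filter (fun j => i < j), (p i j • Qs i + (p i j)⁻¹ • Qs j)) :
    Q.IsSymm ∧ Q.PosDef ∧
      (∑ i : Fin k, {x : Fin n → ℝ | x ⬝ᵥ ((Qs i)⁻¹ *ᵥ x) ≤ 1}) ⊆
        {x : Fin n → ℝ | x ⬝ᵥ (Q⁻¹ *ᵥ x) ≤ 1} := by
  have h_rest : (∑ i, ∑ j ∈ univ.filter (fun j => i < j),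
      (p i j • Qs i + (p i j)⁻¹ • Qs j)).PosSemidef := by
    refine posSemidef_sum _ fun i _ => posSemidef_sum _ fun j hj => ?_
    have hpos := hp i j (mem_filter.mp hj).2
    exact ((hQpos i).posSemidef.smul hpos.le).add
      ((hQpos j).posSemidef.smul (inv_nonneg.mpr hpos.le))
  have h_sum : (∑ i, Qs i).PosDef := by
    rw [← add_sum_erase _ _ (mem_univ (⟨0, hk⟩ : Fin k))]
    exact (hQpos _).add_posSemidef (posSemidef_sum _ fun i _ => (hQpos i).posSemidef)
  have hQpd : Q.PosDef := hQ ▸ h_sum.add_posSemidef h_rest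
  refine ⟨by simpa [IsSymm] using hQpd.isHermitian.eq, hQpd, ?_⟩
  rintro x hx
  obtain ⟨g, hg, rfl⟩ := Set.mem_fintype_sum _ _ |>.mp hx
  set x := ∑ i, g i with hxdef
  set y := Q⁻¹ *ᵥ x with hy
  have hQy : Q *ᵥ y = x := by
    rw [hy, mulVec_mulVec, mul_nonsing_inv _ ((isUnit_iff_isUnit_det Q).mp hQpd.isUnit),
      one_mulVec]
  have h_le : ∀ i, (y ⬝ᵥ g i) ^ 2 ≤ y ⬝ᵥ (Qs i *ᵥ y) := fun i =>
    sq_dotProduct_le_of_mem_ellipsoid (hQpos i) (hg i) y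
  have h_form : y ⬝ᵥ (Q *ᵥ y) = ∑ i, y ⬝ᵥ (Qs i *ᵥ y) +
      ∑ i, ∑ j ∈ univ.filter (fun j => i < j),
        (p i j * (y ⬝ᵥ (Qs i *ᵥ y)) + (p i j)⁻¹ * (y ⬝ᵥ (Qs j *ᵥ y))) := by
    rw [hQ]
    simp only [add_mulVec, sum_mulVec, smul_mulVec, dotProduct_add, dotProduct_sum,
      dotProduct_smul, smul_eq_mul]
  have h_main : (y ⬝ᵥ x) ^ 2 ≤ y ⬝ᵥ x := by
    calc (y ⬝ᵥ x) ^ 2 = (∑ i, y ⬝ᵥ g i) ^ 2 := by rw [hxdef, dotProduct_sum]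
      _ ≤ _ := sq_sum_le_of_weights p hp _
      _ ≤ y ⬝ᵥ (Q *ᵥ y) := by
        rw [h_form]
        gcongr with i _ i _ j hj
        · exact h_le i
        · exact (hp i j (mem_filter.mp hj).2).le
        · exact h_le i
        · exact inv_nonneg.mpr (hp i j (mem_filter.mp hj).2).le
        · exact h_le j
      _ = y ⬝ᵥ x := by rw [hQy]
  change x ⬝ᵥ y ≤ 1
  rw [dotProduct_comm]
  nlinarith
end

section
/- Let Q₁, …, Q_k ∈ ℝ^{n×n} be symmetric positive definite and define Q* = ( Σ_{i=1}^k √(tr(Q_i)) ) · ( Σ_{i=1}^k Q_i / √(tr(Q_i)) ). Then Q* is symmetric positive definite, the Minkowski sum ⊕_{i=1}^k E(Q_i) is contained in the ellipsoid E(Q*), and tr(Q*) = ( Σ_{i=1}^k √(tr(Q_i)) )². -/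
open Matrix Finset
open scoped Pointwise

/-- A weighted Young inequality for the dual quadratic forms of `Q` and `Q⁻¹`. -/
lemma Matrix.PosDef.two_mul_dotProduct_le {m : Type*} [Fintype m] [DecidableEq m]
    {Q : Matrix m m ℝ} (hQ : Q.PosDef) (c : ℝ) (x y : m → ℝ) :
    2 * c * (x ⬝ᵥ y) ≤ c ^ 2 * (y ⬝ᵥ (Q *ᵥ y)) + x ⬝ᵥ (Q⁻¹ *ᵥ x) := by
  have hdet : IsUnit Q.det := Q.isUnit_iff_isUnit_det.mp hQ.isUnit
  have h := hQ.posSemidef.dotProduct_mulVec_nonneg (c • y - Q⁻¹ *ᵥ x)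
  have hQx : Q *ᵥ (Q⁻¹ *ᵥ x) = x := by
    rw [mulVec_mulVec, mul_nonsing_inv Q hdet, one_mulVec]
  have hsymm : Qᵀ = Q := by
    simpa only [conjTranspose_eq_transpose_of_trivial] using hQ.isHermitian.eq
  have hcross : (Q⁻¹ *ᵥ x) ⬝ᵥ (Q *ᵥ y) = x ⬝ᵥ y := by
    rw [dotProduct_mulVec, ← mulVec_transpose, hsymm, hQx]
  rw [star_trivial, mulVec_sub, mulVec_smul, hQx] at h
  simp only [sub_dotProduct, dotProduct_sub, smul_dotProduct, dotProduct_smul, smul_eq_mul,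
    hcross] at h
  rw [dotProduct_comm y x, dotProduct_comm (Q⁻¹ *ᵥ x) x] at h
  linarith

/-- For symmetric positive definite `Q₁, …, Q_k` and
`Q* = (Σᵢ √tr(Qᵢ)) · (Σᵢ Qᵢ / √tr(Qᵢ))`, the matrix `Q*` is symmetric positive definite,
the Minkowski sum `⊕ᵢ E(Qᵢ)` is contained in `E(Q*)`, and `tr(Q*) = (Σᵢ √tr(Qᵢ))²`. -/
theorem stmt_5 {n k : ℕ} (hk : 0 < k) (Qs : Fin k → Matrix (Fin n) (Fin n) ℝ)
    (hQsymm : ∀ i, (Qs i).IsSymm) (hQpos : ∀ i, (Qs i).PosDef)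
    (Qstar : Matrix (Fin n) (Fin n) ℝ)
    (hQstar : Qstar = (∑ i, Real.sqrt ((Qs i).trace)) •
        ∑ i, (Real.sqrt ((Qs i).trace))⁻¹ • Qs i) :
    Qstar.IsSymm ∧ Qstar.PosDef ∧
      (∑ i : Fin k, {x : Fin n → ℝ | x ⬝ᵥ ((Qs i)⁻¹ *ᵥ x) ≤ 1}) ⊆
        {x : Fin n → ℝ | x ⬝ᵥ (Qstar⁻¹ *ᵥ x) ≤ 1} ∧
      Qstar.trace = (∑ i, Real.sqrt ((Qs i).trace)) ^ 2 := by
  have hsymm : Qstar.IsSymm := by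
    simp [hQstar, IsSymm, transpose_smul, transpose_sum, fun i => (hQsymm i).eq]
  have htrace : Qstar.trace = (∑ i, Real.sqrt ((Qs i).trace)) ^ 2 := by
    rw [hQstar, trace_smul, trace_sum, sq, smul_eq_mul]
    congr 1
    refine sum_congr rfl fun i _ => ?_
    rw [trace_smul, smul_eq_mul, inv_mul_eq_div, Real.div_sqrt]
  rcases isEmpty_or_nonempty (Fin n) with hn | hn
  · refine ⟨hsymm, ?_, fun x _ => by simp [dotProduct], htrace⟩
    exact Subsingleton.elim (Qs ⟨0, hk⟩) Qstar ▸ hQpos _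
  have : Nonempty (Fin k) := ⟨⟨0, hk⟩⟩
  set t : Fin k → ℝ := fun i => Real.sqrt ((Qs i).trace) with ht
  have htpos : ∀ i, 0 < t i := fun i => Real.sqrt_pos.mpr (hQpos i).trace_pos
  set s : ℝ := ∑ i, t i with hs
  have hspos : 0 < s := sum_pos (fun i _ => htpos i) univ_nonempty
  have hpos : Qstar.PosDef := by
    rw [hQstar]
    exact (posDef_sum univ_nonempty fun i _ =>
      (hQpos i).smul (inv_pos.mpr (htpos i))).smul hspos
  refine ⟨hsymm, hpos, fun x hx => ?_, htrace⟩
  obtain ⟨g, hg, rfl⟩ := (Set.mem_finsetSum _ _ _).mp hx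
  have hdet : IsUnit Qstar.det := Qstar.isUnit_iff_isUnit_det.mp hpos.isUnit
  rw [Set.mem_ofPred_eq]
  set y : Fin n → ℝ := Qstar⁻¹ *ᵥ ∑ i, g i with hy
  have hQy : Qstar *ᵥ y = ∑ i, g i := by
    rw [hy, mulVec_mulVec, mul_nonsing_inv Qstar hdet, one_mulVec]
  have hyy : (∑ i, g i) ⬝ᵥ y = ∑ i, s / t i * (y ⬝ᵥ (Qs i *ᵥ y)) := by
    rw [← hQy, dotProduct_comm, hQstar]
    simp only [smul_mulVec, sum_mulVec, dotProduct_smul, dotProduct_sum, smul_eq_mul, mul_sum,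
      div_eq_mul_inv, mul_assoc, ht]
  have hle : ∀ i, 2 * (g i ⬝ᵥ y) ≤ s / t i * (y ⬝ᵥ (Qs i *ᵥ y)) + t i / s := fun i => by
    have hgi : g i ⬝ᵥ ((Qs i)⁻¹ *ᵥ g i) ≤ 1 := hg (mem_univ i)
    have h := ((hQpos i).two_mul_dotProduct_le (s / t i) (g i) y).trans
      (add_le_add_right hgi _)
    have hti := htpos i
    have h' := mul_le_mul_of_nonneg_left h (div_pos hti hspos).le
    calc 2 * (g i ⬝ᵥ y) = t i / s * (2 * (s / t i) * (g i ⬝ᵥ y)) := by field_simp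
      _ ≤ _ := h'
      _ = _ := by field_simp
  have hsum := sum_le_sum fun i (_ : i ∈ univ) => hle i
  rw [sum_add_distrib, ← hyy, ← mul_sum, ← sum_dotProduct, ← sum_div, ← hs,
    div_self hspos.ne'] at hsum
  linarith
end

section
/- Let F, A ∈ ℝ^{n×n} be matrices whose complex eigenvalues all have modulus strictly less than 1, and let M, R ∈ ℝ^{n×n} be symmetric positive semidefinite. With H_i = Aⁱ − Fⁱ, the two series Σ_{i=0}^∞ √( tr( H_i M H_iᵀ ) ) and Σ_{i=0}^∞ √( tr( Fⁱ R (Fⁱ)ᵀ ) ) both converge to finite values. Consequently, the minimum-trace ellipsoidal outer bound of the infinite-horizon reachable set has finite trace and hence is a bounded ellipsoid. -/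
open Matrix

open scoped MatrixOrder ComplexOrder Matrix.Norms.L2Operator in
theorem Matrix.PosSemidef.exists_eq_conjTranspose_mul_self {𝕜 m : Type*} [RCLike 𝕜] [Fintype m]
    [DecidableEq m] {M : Matrix m m 𝕜} (hM : M.PosSemidef) : ∃ B : Matrix m m 𝕜, M = Bᴴ * B :=
  CStarAlgebra.nonneg_iff_eq_star_mul_self.1 hM.nonneg

section

attribute [local instance] Matrix.frobeniusNormedAddCommGroup Matrix.frobeniusNormedSpace
  Matrix.frobeniusNormedRing Matrix.frobeniusNormedAlgebra

/-- In a complex Banach algebra, an element whose spectrum lies in the open unit disc has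
absolutely summable powers. -/
theorem summable_norm_pow_of_spectrum_norm_lt_one {B : Type*} [NormedRing B] [NormedAlgebra ℂ B]
    [CompleteSpace B] (a : B) (ha : ∀ μ ∈ spectrum ℂ a, ‖μ‖ < 1) :
    Summable fun i : ℕ => ‖a ^ i‖ := by
  rcases subsingleton_or_nontrivial B with hB | hB
  · simp [Subsingleton.elim _ (0 : B)]
  have hlt : spectralRadius ℂ a < (1 : NNReal) :=
    spectrum.spectralRadius_lt_of_forall_lt a fun μ hμ => by exact_mod_cast ha μ hμ
  obtain ⟨r, har, hr⟩ := ENNReal.lt_iff_exists_nnreal_btwn.1 hlt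
  have hev := (spectrum.pow_nnnorm_pow_one_div_tendsto_nhds_spectralRadius a).eventually_lt_const har
  have hgeom : Summable fun i : ℕ => (r : ℝ) ^ i :=
    summable_geometric_of_lt_one r.2 (by exact_mod_cast hr)
  refine summable_of_isBigO_nat hgeom (Asymptotics.IsBigO.of_bound 1 ?_)
  filter_upwards [hev, Filter.eventually_gt_atTop 0] with i hi hi0
  have hi' : (0 : ℝ) < i := by exact_mod_cast hi0
  have h := ENNReal.rpow_lt_rpow hi hi'
  rw [← ENNReal.rpow_mul, one_div_mul_cancel hi'.ne', ENNReal.rpow_one, ENNReal.rpow_natCast] at h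
  have h' : ‖a ^ i‖₊ < r ^ i := by exact_mod_cast h
  simpa using (show ‖a ^ i‖ ≤ (r : ℝ) ^ i by exact_mod_cast h'.le)

/-- The powers of a real matrix whose complex eigenvalues lie in the open unit disc are absolutely
summable in the Frobenius norm. -/
theorem Matrix.summable_frobenius_norm_pow {m : Type*} [Fintype m] [DecidableEq m]
    (F : Matrix m m ℝ)
    (hF : ∀ μ : ℂ, μ ∈ spectrum ℂ (F.map (algebraMap ℝ ℂ)) → ‖μ‖ < 1) :
    Summable fun i : ℕ => ‖F ^ i‖ := by
  have h := summable_norm_pow_of_spectrum_norm_lt_one (F.map (algebraMap ℝ ℂ)) hF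
  refine h.congr fun i => ?_
  rw [← Matrix.map_pow]
  exact Matrix.frobenius_norm_map_eq _ _ fun x => by simp

theorem Matrix.sqrt_trace_mul_transpose_eq_frobenius_norm {m k : Type*} [Fintype m] [Fintype k]
    (X : Matrix m k ℝ) : √(X * Xᵀ).trace = ‖X‖ := by
  rw [Matrix.frobenius_norm_def, ← Real.sqrt_eq_rpow]
  simp [Matrix.trace, Matrix.mul_apply, sq]

/-- For a positive semidefinite weight `M`, the square root of `tr (X M Xᵀ)` is summable along
every absolutely summable sequence of matrices. -/
theorem Matrix.PosSemidef.summable_sqrt_trace {m : Type*} [Fintype m] [DecidableEq m]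
    {M : Matrix m m ℝ} (hM : M.PosSemidef) {X : ℕ → Matrix m m ℝ}
    (hX : Summable fun i => ‖X i‖) :
    Summable fun i => √(X i * M * (X i)ᵀ).trace := by
  obtain ⟨B, rfl⟩ := hM.exists_eq_conjTranspose_mul_self
  refine (hX.mul_right ‖Bᵀ‖).of_nonneg_of_le (fun i => Real.sqrt_nonneg _) fun i => ?_
  have h : X i * (Bᴴ * B) * (X i)ᵀ = (X i * Bᵀ) * (X i * Bᵀ)ᵀ := by
    simp [Matrix.conjTranspose_eq_transpose_of_trivial, Matrix.mul_assoc]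
  rw [h, Matrix.sqrt_trace_mul_transpose_eq_frobenius_norm]
  exact Matrix.frobenius_norm_mul _ _

theorem Matrix.summable_frobenius_norm_sub {m k : Type*} [Fintype m] [Fintype k]
    {X Y : ℕ → Matrix m k ℝ} (hX : Summable fun i => ‖X i‖) (hY : Summable fun i => ‖Y i‖) :
    Summable fun i => ‖X i - Y i‖ :=
  (hX.add hY).of_nonneg_of_le (fun _ => norm_nonneg _) fun _ => norm_sub_le _ _

end

/-- If all complex eigenvalues of `F` and `A` have modulus `< 1` and
`M, R` are symmetric positive semidefinite, then with `H_i = Aⁱ − Fⁱ` both series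
`Σᵢ √tr(H_i M H_iᵀ)` and `Σᵢ √tr(Fⁱ R (Fⁱ)ᵀ)` converge (so the minimum-trace ellipsoidal
outer bound of the infinite-horizon reachable set has finite trace and is bounded). -/
theorem stmt_8 {n : ℕ} (F A M R : Matrix (Fin n) (Fin n) ℝ)
    (hF : ∀ μ : ℂ, μ ∈ spectrum ℂ (F.map (algebraMap ℝ ℂ)) → ‖μ‖ < 1)
    (hA : ∀ μ : ℂ, μ ∈ spectrum ℂ (A.map (algebraMap ℝ ℂ)) → ‖μ‖ < 1)
    (hMsymm : M.IsSymm) (hM : M.PosSemidef)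
    (hRsymm : R.IsSymm) (hR : R.PosSemidef) :
    (Summable fun i : ℕ =>
      Real.sqrt (((A ^ i - F ^ i) * M * (A ^ i - F ^ i)ᵀ).trace)) ∧
    (Summable fun i : ℕ => Real.sqrt ((F ^ i * R * (F ^ i)ᵀ).trace)) := by
  have hFs := F.summable_frobenius_norm_pow hF
  have hAs := A.summable_frobenius_norm_pow hA
  exact ⟨hM.summable_sqrt_trace (Matrix.summable_frobenius_norm_sub hAs hFs),
    hR.summable_sqrt_trace hFs⟩
end

section
/- Let A ∈ ℝ^{n×n} have all complex eigenvalues of modulus strictly less than 1 and let R ∈ ℝ^{n×n}. Then the series P = Σ_{q=0}^∞ A^q R (A^q)ᵀ converges, the limit P satisfies the discrete Lyapunov equation P = A P Aᵀ + R, and P is the unique matrix in ℝ^{n×n} satisfying this equation. -/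
open Matrix

/-- In a complex Banach algebra, an element of spectral radius `< 1` has geometrically decaying
powers. -/
theorem eventually_norm_pow_le_of_spectralRadius_lt_one {B : Type*} [NormedRing B]
    [NormedAlgebra ℂ B] [CompleteSpace B] {a : B} (ha : spectralRadius ℂ a < 1) :
    ∃ r : ℝ, 0 ≤ r ∧ r < 1 ∧ ∀ᶠ q : ℕ in Filter.atTop, ‖a ^ q‖ ≤ r ^ q := by
  obtain ⟨r, har, hr⟩ := ENNReal.lt_iff_exists_nnreal_btwn.1 ha
  refine ⟨r, r.coe_nonneg, by exact_mod_cast hr, ?_⟩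
  filter_upwards [(spectrum.pow_nnnorm_pow_one_div_tendsto_nhds_spectralRadius a).eventually
    (gt_mem_nhds har), Filter.eventually_gt_atTop 0] with q hq hq0
  have hq' : (0 : ℝ) < q := by exact_mod_cast hq0
  have h := (ENNReal.rpow_lt_rpow hq hq').le
  rw [← ENNReal.rpow_mul, one_div_mul_cancel hq'.ne', ENNReal.rpow_one,
    ENNReal.rpow_natCast] at h
  exact_mod_cast h

/-- If every point of the spectrum lies in the open unit disc, the spectral radius is `< 1`;
unlike `spectrum.spectralRadius_lt_of_forall_lt`, this allows the trivial algebra. -/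
theorem spectralRadius_lt_one_of_forall_norm_lt_one {B : Type*} [NormedRing B]
    [NormedAlgebra ℂ B] [CompleteSpace B] {a : B} (ha : ∀ μ ∈ spectrum ℂ a, ‖μ‖ < 1) :
    spectralRadius ℂ a < 1 := by
  cases subsingleton_or_nontrivial B
  · simp
  · exact_mod_cast spectrum.spectralRadius_lt_of_forall_lt a (r := 1) fun μ hμ => ha μ hμ

section Frobenius

open scoped Matrix.Norms.Frobenius

theorem Matrix.summable_pow_mul_mul_transpose_pow {n : Type*} [Fintype n] [DecidableEq n]
    (A R : Matrix n n ℝ)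
    (hA : ∀ μ : ℂ, μ ∈ spectrum ℂ (A.map (algebraMap ℝ ℂ)) → ‖μ‖ < 1) :
    Summable fun q : ℕ => A ^ q * R * (A ^ q)ᵀ := by
  have : CompleteSpace (Matrix n n ℂ) := FiniteDimensional.complete ℂ _
  obtain ⟨r, hr0, hr1, hr⟩ := eventually_norm_pow_le_of_spectralRadius_lt_one
    (spectralRadius_lt_one_of_forall_norm_lt_one hA)
  have hpow (q : ℕ) : ‖A.map (algebraMap ℝ ℂ) ^ q‖ = ‖A ^ q‖ := by
    rw [← Matrix.map_pow, frobenius_norm_map_eq _ _ fun x => norm_algebraMap' ℂ x]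
  have hsum : Summable fun q : ℕ => ‖R‖ * (r * r) ^ q :=
    (summable_geometric_of_lt_one (by positivity) (by nlinarith)).mul_left _
  refine hsum.of_norm_bounded_eventually_nat ?_
  filter_upwards [hr] with q hq
  rw [hpow] at hq
  calc ‖A ^ q * R * (A ^ q)ᵀ‖ ≤ ‖A ^ q‖ * ‖R‖ * ‖(A ^ q)ᵀ‖ :=
        (norm_mul_le _ _).trans (by gcongr; exact norm_mul_le _ _)
    _ ≤ r ^ q * ‖R‖ * r ^ q := by rw [frobenius_norm_transpose]; gcongr
    _ = ‖R‖ * (r * r) ^ q := by rw [mul_pow]; ring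

end Frobenius

theorem Matrix.eq_pow_mul_mul_transpose_pow {n α : Type*} [Fintype n] [DecidableEq n]
    [CommSemiring α] {A D : Matrix n n α} (hD : D = A * D * Aᵀ) (q : ℕ) :
    D = A ^ q * D * (A ^ q)ᵀ := by
  induction q with
  | zero => simp
  | succ q ih =>
    calc D = A ^ q * (A * D * Aᵀ) * (A ^ q)ᵀ := by rw [← hD]; exact ih
      _ = A ^ (q + 1) * D * (A ^ (q + 1))ᵀ := by
        simp only [pow_succ, transpose_mul, Matrix.mul_assoc]

/-- If all complex eigenvalues of `A` have modulus `< 1`, the series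
`P = Σ_q A^q R (A^q)ᵀ` converges, its limit satisfies the discrete Lyapunov equation
`P = A P Aᵀ + R`, and it is the unique solution of that equation. -/
theorem stmt_9 {n : ℕ} (A R : Matrix (Fin n) (Fin n) ℝ)
    (hA : ∀ μ : ℂ, μ ∈ spectrum ℂ (A.map (algebraMap ℝ ℂ)) → ‖μ‖ < 1) :
    (Summable fun q : ℕ => A ^ q * R * (A ^ q)ᵀ) ∧
    (∑' q : ℕ, A ^ q * R * (A ^ q)ᵀ) =
      A * (∑' q : ℕ, A ^ q * R * (A ^ q)ᵀ) * Aᵀ + R ∧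
    (∀ P : Matrix (Fin n) (Fin n) ℝ, P = A * P * Aᵀ + R →
      P = ∑' q : ℕ, A ^ q * R * (A ^ q)ᵀ) := by
  have hsum := fun M => summable_pow_mul_mul_transpose_pow A M hA
  have hS : (∑' q : ℕ, A ^ q * R * (A ^ q)ᵀ) =
      A * (∑' q : ℕ, A ^ q * R * (A ^ q)ᵀ) * Aᵀ + R := by
    rw [← (hsum R).tsum_mul_left, ← ((hsum R).mul_left A).tsum_mul_right,
      (hsum R).tsum_eq_zero_add, add_comm]
    simp only [pow_succ', pow_zero, transpose_mul, transpose_one, Matrix.mul_assoc,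
      Matrix.one_mul, Matrix.mul_one]
  refine ⟨hsum R, hS, fun P hP => ?_⟩
  set S := ∑' q : ℕ, A ^ q * R * (A ^ q)ᵀ
  have hD : P - S = A * (P - S) * Aᵀ := by
    calc P - S = (A * P * Aᵀ + R) - (A * S * Aᵀ + R) := by rw [← hP, ← hS]
      _ = A * (P - S) * Aᵀ := by rw [Matrix.mul_sub, Matrix.sub_mul]; abel
  have hlim := (hsum (P - S)).tendsto_atTop_zero
  simp only [← eq_pow_mul_mul_transpose_pow hD] at hlim
  exact sub_eq_zero.1 (tendsto_nhds_unique tendsto_const_nhds hlim)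
end

section
/- Let F ∈ ℝ^{n×n}, G ∈ ℝ^{n×m}, K ∈ ℝ^{m×n}, L ∈ ℝ^{n×p}, S ∈ ℝ^{p×p}, and let (ν_k)_{k≥0} in ℝⁿ and (δ_k)_{k≥0} in ℝ^p be arbitrary sequences. Define (e_k) and (x_k) in ℝⁿ by e₀ = 0, x₀ = 0, e_{k+1} = F e_k − L S δ_k + ν_k, and x_{k+1} = (F + GK) x_k − GK e_k + ν_k. Then for every k ≥ 1, x_k = Σ_{i=0}^{k−1} Fⁱ ν_{k−1−i} + Σ_{i=1}^{k−1} H_i L S δ_{k−1−i}, where H_i = (F + GK)ⁱ − Fⁱ. -/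
open Matrix Finset

/-- Variation of constants for a discrete-time linear recursion started at zero. -/
theorem linear_recursion_eq_sum {ι R : Type*} [Fintype ι] [DecidableEq ι] [Semiring R]
    (A : Matrix ι ι R) (w z : ℕ → ι → R) (hz0 : z 0 = 0)
    (hz : ∀ k, z (k + 1) = A *ᵥ z k + w k) (k : ℕ) :
    z k = ∑ i ∈ range k, (A ^ i) *ᵥ w (k - 1 - i) := by
  induction k with
  | zero => simpa using hz0
  | succ k ih =>
    rw [hz, ih, sum_range_succ', mulVec_sum]
    congr 1
    · refine sum_congr rfl fun i _ => ?_
      rw [mulVec_mulVec, ← pow_succ', show k + 1 - 1 - (i + 1) = k - 1 - i by omega]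
    · simp

/-- The closed-form solution of the closed-loop state recursion
`e₀ = 0`, `x₀ = 0`, `e_{k+1} = F e_k − L S δ_k + ν_k`,
`x_{k+1} = (F + GK) x_k − GK e_k + ν_k`: for every `k ≥ 1`,
`x_k = Σ_{i=0}^{k−1} Fⁱ ν_{k−1−i} + Σ_{i=1}^{k−1} H_i L S δ_{k−1−i}`,
where `H_i = (F + GK)ⁱ − Fⁱ`. -/
theorem stmt_11 {n m p : ℕ} (F : Matrix (Fin n) (Fin n) ℝ)
    (G : Matrix (Fin n) (Fin m) ℝ) (K : Matrix (Fin m) (Fin n) ℝ)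
    (L : Matrix (Fin n) (Fin p) ℝ) (S : Matrix (Fin p) (Fin p) ℝ)
    (ν : ℕ → Fin n → ℝ) (δ : ℕ → Fin p → ℝ)
    (e x : ℕ → Fin n → ℝ) (he0 : e 0 = 0) (hx0 : x 0 = 0)
    (he : ∀ k, e (k + 1) = F *ᵥ e k - L *ᵥ (S *ᵥ δ k) + ν k)
    (hx : ∀ k, x (k + 1) = (F + G * K) *ᵥ x k - (G * K) *ᵥ e k + ν k)
    (H : ℕ → Matrix (Fin n) (Fin n) ℝ) (hH : ∀ i, H i = (F + G * K) ^ i - F ^ i) :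
    ∀ k, 1 ≤ k →
      x k = ∑ i ∈ range k, (F ^ i) *ᵥ ν (k - 1 - i) +
            ∑ i ∈ Ico 1 k, (H i * L * S) *ᵥ δ (k - 1 - i) := by
  intro k hk
  have h_err := linear_recursion_eq_sum F (fun j => ν j - (L * S) *ᵥ δ j) e he0
    (fun j => by rw [he, mulVec_mulVec]; abel) k
  have h_est := linear_recursion_eq_sum (F + G * K) (fun j => (L * S) *ᵥ δ j) (x - e)
    (by simp [he0, hx0])
    (fun j => by
      simp only [Pi.sub_apply, hx, he, mulVec_sub, add_mulVec, mulVec_mulVec]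
      abel) k
  have h_sum : ∑ i ∈ Ico 1 k, (H i * L * S) *ᵥ δ (k - 1 - i) =
      ∑ i ∈ range k, (H i * L * S) *ᵥ δ (k - 1 - i) := by
    rw [range_eq_Ico, sum_eq_sum_Ico_succ_bot hk]
    simp [hH]
  rw [h_sum, ← sub_add_cancel (x k) (e k), ← Pi.sub_apply, h_est, h_err,
    ← sum_add_distrib, ← sum_add_distrib]
  refine sum_congr rfl fun i _ => ?_
  simp only [hH, mulVec_sub, mulVec_mulVec, Matrix.sub_mul, sub_mulVec, Matrix.mul_assoc]
  abel
end

section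
/- Let F ∈ ℝ^{n×n} be invertible, G ∈ ℝ^{n×m}, K ∈ ℝ^{m×n}, L ∈ ℝ^{n×p}, and let Σ ∈ ℝ^{p×p} be symmetric positive definite with symmetric square root S = Σ^{1/2}. Let ν̄ > 0, α > 0, let R₁ ∈ ℝ^{n×n} be symmetric positive definite, and fix k ≥ 2. Set H_i = (F + GK)ⁱ − Fⁱ and assume that for each i ∈ {1, …, k−1} the matrix α H_i L Σ Lᵀ H_iᵀ is positive definite. Suppose the sequences (ν_j) and (δ_j) satisfy ν_jᵀ R₁⁻¹ ν_j ≤ ν̄ and δ_jᵀ δ_j ≤ α for all j, and define (e_k), (x_k) by e₀ = 0, x₀ = 0, e_{j+1} = F e_j − L S δ_j + ν_j, x_{j+1} = (F + GK) x_j − GK e_j + ν_j. Then x_k ∈ ( ⊕_{i=0}^{k−1} E( ν̄ Fⁱ R₁ (Fⁱ)ᵀ ) ) ⊕ ( ⊕_{i=1}^{k−1} E( α H_i L Σ Lᵀ H_iᵀ ) ). -/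
open Matrix Finset
open scoped Pointwise

/-- A linear map `B` sends the ellipsoid `E(a P)` into the ellipsoid `E(a B P Bᵀ)`. -/
theorem mulVec_mem_ellipsoid {n q : Type*} [Fintype n] [DecidableEq n] [Fintype q] [DecidableEq q]
    (B : Matrix n q ℝ) (P : Matrix q q ℝ) (hP : P.PosDef) (Q : Matrix n n ℝ) (hQ : IsUnit Q)
    {a : ℝ} (ha : 0 < a) (hQP : Q = a • (B * P * Bᵀ)) (w : q → ℝ) (hw : w ⬝ᵥ (P⁻¹ *ᵥ w) ≤ a) :
    (B *ᵥ w) ⬝ᵥ (Q⁻¹ *ᵥ (B *ᵥ w)) ≤ 1 := by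
  set u := Q⁻¹ *ᵥ (B *ᵥ w)
  set v := Bᵀ *ᵥ u
  have hPdet : IsUnit P.det := (Matrix.isUnit_iff_isUnit_det P).1 hP.isUnit
  have hQu : Q *ᵥ u = B *ᵥ w := by
    rw [Matrix.mulVec_mulVec, Matrix.mul_nonsing_inv _ ((Matrix.isUnit_iff_isUnit_det Q).1 hQ),
      Matrix.one_mulVec]
  have hwv : (B *ᵥ w) ⬝ᵥ u = w ⬝ᵥ v := by
    rw [dotProduct_comm, Matrix.dotProduct_mulVec, ← Matrix.mulVec_transpose, dotProduct_comm]
  have hvv : a * (v ⬝ᵥ (P *ᵥ v)) = w ⬝ᵥ v := by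
    rw [← hwv, ← hQu, hQP, Matrix.smul_mulVec, smul_dotProduct, smul_eq_mul,
      ← Matrix.mulVec_mulVec, ← Matrix.mulVec_mulVec, dotProduct_comm _ u,
      Matrix.dotProduct_mulVec u, ← Matrix.mulVec_transpose B u]
  have hPPv : P⁻¹ *ᵥ (P *ᵥ v) = v := by
    rw [Matrix.mulVec_mulVec, Matrix.nonsing_inv_mul _ hPdet, Matrix.one_mulVec]
  have hPsymm : Pᵀ = P := by
    simpa [Matrix.IsHermitian, Matrix.conjTranspose_eq_transpose_of_trivial] using hP.isHermitian
  have hcross : (P *ᵥ v) ⬝ᵥ (P⁻¹ *ᵥ w) = w ⬝ᵥ v := by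
    rw [dotProduct_comm, Matrix.dotProduct_mulVec, ← Matrix.mulVec_transpose, hPsymm,
      Matrix.mulVec_mulVec, Matrix.mul_nonsing_inv _ hPdet, Matrix.one_mulVec]
  have hnonneg := hP.inv.posSemidef.dotProduct_mulVec_nonneg (w - a • (P *ᵥ v))
  simp only [star_trivial, Matrix.mulVec_sub, Matrix.mulVec_smul, hPPv, sub_dotProduct,
    dotProduct_sub, smul_dotProduct, dotProduct_smul, hcross, smul_eq_mul,
    dotProduct_comm (P *ᵥ v) v, hvv] at hnonneg
  rw [hwv]
  nlinarith

/-- Variation of constants for a discrete-time linear system started at the origin. -/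
theorem linear_recurrence_eq_sum {n : Type*} [Fintype n] [DecidableEq n] (A : Matrix n n ℝ)
    (z f : ℕ → n → ℝ) (hz0 : z 0 = 0) (hz : ∀ j, z (j + 1) = A *ᵥ z j + f j) (k : ℕ) :
    z k = ∑ i ∈ range k, A ^ i *ᵥ f (k - 1 - i) := by
  induction k with
  | zero => simp [hz0]
  | succ k ih =>
    rw [hz, ih, Finset.sum_range_succ', Matrix.mulVec_sum]
    simp only [Matrix.mulVec_mulVec, ← pow_succ', pow_zero, Matrix.one_mulVec,
      Nat.add_sub_cancel, Nat.sub_zero]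
    congr 1
    refine Finset.sum_congr rfl fun i _ => ?_
    rw [Nat.sub_sub, Nat.add_comm 1 i]

/-- Under a stealthy attack (`δ_jᵀ δ_j ≤ α`) and truncated process noise
(`ν_jᵀ R₁⁻¹ ν_j ≤ νbar`), the closed-loop state `x_k` of the attacked system lies in the
Minkowski sum `(⊕_{i=0}^{k−1} E(νbar Fⁱ R₁ (Fⁱ)ᵀ)) ⊕ (⊕_{i=1}^{k−1} E(α H_i L Σ Lᵀ H_iᵀ))`,
where `H_i = (F + GK)ⁱ − Fⁱ` and `E(Q) = {y | yᵀ Q⁻¹ y ≤ 1}`. -/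
theorem stmt_12 {n m p : ℕ}
    (F : Matrix (Fin n) (Fin n) ℝ) (hF : IsUnit F)
    (G : Matrix (Fin n) (Fin m) ℝ) (K : Matrix (Fin m) (Fin n) ℝ)
    (L : Matrix (Fin n) (Fin p) ℝ)
    (Sig S : Matrix (Fin p) (Fin p) ℝ)
    (hSig : Sig.PosDef) (hSigsymm : Sig.IsSymm)
    (hS : S.PosDef) (hSsymm : S.IsSymm) (hSS : S * S = Sig)
    (νbar α : ℝ) (hνbar : 0 < νbar) (hα : 0 < α)
    (R₁ : Matrix (Fin n) (Fin n) ℝ) (hR₁ : R₁.PosDef) (hR₁symm : R₁.IsSymm)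
    (k : ℕ) (hk : 2 ≤ k)
    (H : ℕ → Matrix (Fin n) (Fin n) ℝ) (hH : ∀ i, H i = (F + G * K) ^ i - F ^ i)
    (hHpd : ∀ i, 1 ≤ i → i < k → (α • (H i * L * Sig * Lᵀ * (H i)ᵀ)).PosDef)
    (ν : ℕ → Fin n → ℝ) (δ : ℕ → Fin p → ℝ)
    (hν : ∀ j, ν j ⬝ᵥ (R₁⁻¹ *ᵥ ν j) ≤ νbar) (hδ : ∀ j, δ j ⬝ᵥ δ j ≤ α)
    (e x : ℕ → Fin n → ℝ) (he0 : e 0 = 0) (hx0 : x 0 = 0)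
    (he : ∀ j, e (j + 1) = F *ᵥ e j - L *ᵥ (S *ᵥ δ j) + ν j)
    (hx : ∀ j, x (j + 1) = (F + G * K) *ᵥ x j - (G * K) *ᵥ e j + ν j) :
    x k ∈
      (∑ i ∈ range k,
        {y : Fin n → ℝ | y ⬝ᵥ ((νbar • (F ^ i * R₁ * (F ^ i)ᵀ))⁻¹ *ᵥ y) ≤ 1}) +
      (∑ i ∈ Ico 1 k,
        {y : Fin n → ℝ | y ⬝ᵥ ((α • (H i * L * Sig * Lᵀ * (H i)ᵀ))⁻¹ *ᵥ y) ≤ 1}) := by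
  have he_sum := linear_recurrence_eq_sum F e (fun j => ν j - L *ᵥ (S *ᵥ δ j)) he0
    (fun j => by rw [he]; abel) k
  have hz_sum := linear_recurrence_eq_sum (F + G * K) (fun j => x j - e j)
    (fun j => L *ᵥ (S *ᵥ δ j)) (by simp [hx0, he0])
    (fun j => by simp only [hx, he, Matrix.mulVec_sub, Matrix.add_mulVec]; abel) k
  have hx_sum : x k = ∑ i ∈ range k, F ^ i *ᵥ ν (k - 1 - i) +
      ∑ i ∈ Ico 1 k, (H i * L) *ᵥ (S *ᵥ δ (k - 1 - i)) := by
    have hIco : ∑ i ∈ Ico 1 k, (H i * L) *ᵥ (S *ᵥ δ (k - 1 - i)) =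
        ∑ i ∈ range k, (H i * L) *ᵥ (S *ᵥ δ (k - 1 - i)) := by
      rw [Finset.range_eq_Ico, Finset.sum_eq_sum_Ico_succ_bot (by omega : 0 < k)]
      simp [hH]
    rw [hIco, ← sub_add_cancel (x k) (e k), hz_sum, he_sum, ← Finset.sum_add_distrib,
      ← Finset.sum_add_distrib]
    refine Finset.sum_congr rfl fun i _ => ?_
    rw [hH, ← Matrix.mulVec_mulVec _ _ L, Matrix.sub_mulVec, Matrix.mulVec_sub]
    abel
  rw [hx_sum]
  refine Set.add_mem_add (Set.finsetSum_mem_finsetSum _ _ _ fun i _ => ?_)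
    (Set.finsetSum_mem_finsetSum _ _ _ fun i hi => ?_)
  · refine mulVec_mem_ellipsoid (F ^ i) R₁ hR₁ _ ?_ hνbar rfl _ (hν _)
    have hFi : IsUnit (F ^ i) := hF.pow i
    have hunit : IsUnit (F ^ i * R₁ * (F ^ i)ᵀ) :=
      (hFi.mul hR₁.isUnit).mul ((Matrix.isUnit_transpose _).2 hFi)
    exact hunit.smul (Units.mk0 νbar hνbar.ne')
  · rw [Finset.mem_Ico] at hi
    refine mulVec_mem_ellipsoid (H i * L) Sig hSig _ (hHpd i hi.1 hi.2).isUnit hα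
      (by simp only [Matrix.transpose_mul, Matrix.mul_assoc]) _ ?_
    have hSdet : IsUnit S.det := (Matrix.isUnit_iff_isUnit_det S).1 hS.isUnit
    rw [← hSS, Matrix.mul_inv_rev, Matrix.mulVec_mulVec, Matrix.mul_assoc,
      Matrix.nonsing_inv_mul _ hSdet, Matrix.mul_one, dotProduct_comm,
      Matrix.dotProduct_mulVec, ← Matrix.mulVec_transpose, hSsymm.eq, Matrix.mulVec_mulVec,
      Matrix.mul_nonsing_inv _ hSdet, Matrix.one_mulVec]
    exact hδ _
end

section
/- Let F ∈ ℝ^{n×n}, G ∈ ℝ^{n×m}, K ∈ ℝ^{m×n}, L ∈ ℝ^{n×p}, and let N ≥ 1 be an integer. Then ((F + GK)ⁱ − Fⁱ) L = 0 for every i ∈ {1, …, N} if and only if G K F^{i−1} L = 0 for every i ∈ {1, …, N}. -/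
open Matrix

/-- One-step recursion for the difference between the powers of a perturbed matrix and those of
the original one. -/
theorem add_pow_succ_sub_pow_succ_mul {n p R : Type*} [Fintype n] [DecidableEq n] [Ring R]
    (F E : Matrix n n R) (L : Matrix n p R) (j : ℕ) :
    ((F + E) ^ (j + 1) - F ^ (j + 1)) * L =
      (F + E) * (((F + E) ^ j - F ^ j) * L) + E * F ^ j * L := by
  rw [← Matrix.mul_assoc, ← Matrix.add_mul, pow_succ', pow_succ']
  congr 1
  noncomm_ring

/-- `((F + GK)ⁱ − Fⁱ) L = 0` for every `i ∈ {1, …, N}` if and only if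
`G K F^{i−1} L = 0` for every `i ∈ {1, …, N}`. -/
theorem stmt_14 {n m p : ℕ} (F : Matrix (Fin n) (Fin n) ℝ)
    (G : Matrix (Fin n) (Fin m) ℝ) (K : Matrix (Fin m) (Fin n) ℝ)
    (L : Matrix (Fin n) (Fin p) ℝ) (N : ℕ) (hN : 1 ≤ N) :
    (∀ i, 1 ≤ i → i ≤ N → ((F + G * K) ^ i - F ^ i) * L = 0) ↔
    (∀ i, 1 ≤ i → i ≤ N → G * K * F ^ (i - 1) * L = 0) := by
  constructor
  · intro h i hi hiN
    obtain ⟨j, rfl⟩ := Nat.exists_eq_add_of_le' hi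
    have hj : ((F + G * K) ^ j - F ^ j) * L = 0 := by
      rcases Nat.eq_zero_or_pos j with rfl | hpos
      · simp
      · exact h j hpos (by omega)
    have hstep := add_pow_succ_sub_pow_succ_mul F (G * K) L j
    rw [h (j + 1) hi hiN, hj, Matrix.mul_zero, zero_add] at hstep
    exact hstep.symm
  · intro h i _ hiN
    induction i with
    | zero => simp
    | succ j ih =>
      have hj : ((F + G * K) ^ j - F ^ j) * L = 0 := by
        rcases Nat.eq_zero_or_pos j with rfl | hpos
        · simp
        · exact ih hpos (by omega)
      have hE : G * K * F ^ j * L = 0 := h (j + 1) (by omega) hiN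
      rw [add_pow_succ_sub_pow_succ_mul, hj, hE, Matrix.mul_zero, add_zero]
end
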